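/- For every finite set S of points in the closed Euclidean unit disk {x ∈ ℝ² : ‖x‖₂ ≤ 1}, there exists a wake-up tree for S rooted at the origin, with edge lengths measured by the Euclidean norm on ℝ², whose makespan is at most 7.9651. -/

import Mathlib

/-- `IsWakeUpTree d p₀ S parent t` : `parent` encodes a rooted spanning tree on the node
node set `{p₀} ∪ S` (each non-root node has a parent among the nodes and reaches the root
by iterating `parent`), the root `p₀` has exactly one child (when there is a non-root
node), every non-root node has at most two children, and `t v` is the sum of the
`d`-distances along the tree path from `p₀` to `v` (so the makespan of the tree is the
maximum of `t` over the nodes). -/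
def IsWakeUpTree {X : Type*} (d : X → X → ℝ) (p₀ : X) (S : Finset X)
    (parent : X → X) (t : X → ℝ) : Prop :=
  t p₀ = 0 ∧
  (∀ p ∈ S, p ≠ p₀ →
      (parent p = p₀ ∨ parent p ∈ S) ∧
      t p = t (parent p) + d (parent p) p ∧
      ∃ n : ℕ, parent^[n] p = p₀) ∧
  -- the root has at most one child
  (∀ x ∈ S, x ≠ p₀ → parent x = p₀ →
      ∀ y ∈ S, y ≠ p₀ → parent y = p₀ → x = y) ∧
  -- the root has a child as soon as there is a non-root node
  ((∃ p ∈ S, p ≠ p₀) → ∃ c ∈ S, c ≠ p₀ ∧ parent c = p₀) ∧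
  -- every non-root node has at most two children
  (∀ q ∈ S, q ≠ p₀ → ∀ x ∈ S, ∀ y ∈ S, ∀ z ∈ S,
      x ≠ p₀ → y ≠ p₀ → z ≠ p₀ →
      parent x = q → parent y = q → parent z = q →
      x = y ∨ x = z ∨ y = z)

open Classical in
/-- The parent map of the tree obtained by hanging a root `q` above `c`, whose subtrees are given
by `par₁` on `T₁` and by `par₂` elsewhere. -/
noncomputable def joinParent {X : Type*} (q c : X) (T₁ : Finset X) (par₁ par₂ : X → X) (p : X) : X :=
  if p = c then q else if p ∈ T₁ then par₁ p else par₂ p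

open Classical in
/-- The wake-up times of the tree with parent map `joinParent q c T₁ par₁ par₂`. -/
noncomputable def joinTime {X : Type*} (d : X → X → ℝ) (q c : X) (T₁ : Finset X) (t₁ t₂ : X → ℝ)
    (p : X) : ℝ :=
  if p = q then 0 else if p = c then d q c else d q c + if p ∈ T₁ then t₁ p else t₂ p

namespace IsWakeUpTree

theorem empty {X : Type*} (d : X → X → ℝ) (q : X) : IsWakeUpTree d q ∅ id 0 := by
  simp [IsWakeUpTree]

theorem of_erase {X : Type*} [DecidableEq X] {d : X → X → ℝ} {q : X} {S : Finset X}
    {par : X → X} {t : X → ℝ} (h : IsWakeUpTree d q (S.erase q) par t) :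
    IsWakeUpTree d q S par t := by
  obtain ⟨h0, h1, h2, h3, h4⟩ := h
  simp only [Finset.mem_erase] at h1 h2 h3 h4
  refine ⟨h0, fun p hp hq => ?_,
    fun x hx hxq hx' y hy hyq hy' => h2 x ⟨hxq, hx⟩ hxq hx' y ⟨hyq, hy⟩ hyq hy', ?_,
    fun r hr hrq x hx y hy z hz hxq hyq hzq =>
      h4 r ⟨hrq, hr⟩ hrq x ⟨hxq, hx⟩ y ⟨hyq, hy⟩ z ⟨hzq, hz⟩ hxq hyq hzq⟩
  rotate_left
  · rintro ⟨p, hp, hpq⟩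
    obtain ⟨c, hc, hcq⟩ := h3 ⟨p, ⟨hpq, hp⟩, hpq⟩
    exact ⟨c, hc.2, hcq⟩
  obtain ⟨a, b, e⟩ := h1 p ⟨hq, hp⟩ hq
  exact ⟨a.imp_right And.right, b, e⟩

/-- If `par` agrees with the parent map of a tree rooted at `c`, and sends `c` to `q`, then the
nodes of that tree reach `q` by iterating `par`. -/
theorem exists_iterate_eq {X : Type*} {d : X → X → ℝ} {q c : X} {T : Finset X} {par₁ par : X → X}
    {t : X → ℝ} (h : IsWakeUpTree d c T par₁ t) (hc : c ∉ T) (hpar : ∀ p ∈ T, par p = par₁ p)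
    (hq : par c = q) {p : X} (hp : p ∈ T) : ∃ n : ℕ, par^[n] p = q := by
  have hne : ∀ p ∈ T, p ≠ c := fun p hp h => hc (h ▸ hp)
  obtain ⟨-, -, n, hn⟩ := h.2.1 p hp (hne p hp)
  induction n generalizing p with
  | zero => exact absurd hn (hne p hp)
  | succ n ih =>
    rcases (h.2.1 p hp (hne p hp)).1 with h1 | h1
    · exact ⟨2, by simp [hpar p hp, h1, hq]⟩
    · obtain ⟨m, hm⟩ := ih h1 hn
      exact ⟨m + 1, by simpa [hpar p hp] using hm⟩

open Classical in
/-- Two trees rooted at `c` are joined into one, rooted at `q`, whose root has the only child `c`. -/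
theorem join {X : Type*} {d : X → X → ℝ} {q c : X} {T₁ T₂ : Finset X} {par₁ par₂ : X → X}
    {t₁ t₂ : X → ℝ} (h₁ : IsWakeUpTree d c T₁ par₁ t₁) (h₂ : IsWakeUpTree d c T₂ par₂ t₂)
    (hT : Disjoint T₁ T₂) (hc₁ : c ∉ T₁) (hc₂ : c ∉ T₂) (hq₁ : q ∉ T₁) (hq₂ : q ∉ T₂)
    (hqc : q ≠ c) :
    IsWakeUpTree d q (insert c (T₁ ∪ T₂)) (joinParent q c T₁ par₁ par₂)
      (joinTime d q c T₁ t₁ t₂) := by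
  have hpc : joinParent q c T₁ par₁ par₂ c = q := by simp [joinParent]
  have hp₁ : ∀ p ∈ T₁, joinParent q c T₁ par₁ par₂ p = par₁ p := by
    intro p hp; have : p ≠ c := fun h => hc₁ (h ▸ hp)
    simp [joinParent, hp, this]
  have hp₂ : ∀ p ∈ T₂, joinParent q c T₁ par₁ par₂ p = par₂ p := by
    intro p hp; have : p ≠ c := fun h => hc₂ (h ▸ hp)
    simp [joinParent, Finset.disjoint_right.1 hT hp, this]
  have ht₀ : joinTime d q c T₁ t₁ t₂ q = 0 := by simp [joinTime]
  have htc : joinTime d q c T₁ t₁ t₂ c = d q c := by simp [joinTime, hqc.symm]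
  have ht₁ : ∀ p ∈ T₁, joinTime d q c T₁ t₁ t₂ p = d q c + t₁ p := by
    intro p hp
    have h1 : p ≠ c := fun h => hc₁ (h ▸ hp)
    have h2 : p ≠ q := fun h => hq₁ (h ▸ hp)
    simp [joinTime, hp, h1, h2]
  have ht₂ : ∀ p ∈ T₂, joinTime d q c T₁ t₁ t₂ p = d q c + t₂ p := by
    intro p hp
    have h1 : p ≠ c := fun h => hc₂ (h ▸ hp)
    have h2 : p ≠ q := fun h => hq₂ (h ▸ hp)
    simp [joinTime, Finset.disjoint_right.1 hT hp, h1, h2]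
  have hr₁ := fun p (hp : p ∈ T₁) => h₁.exists_iterate_eq hc₁ hp₁ hpc hp
  have hr₂ := fun p (hp : p ∈ T₂) => h₂.exists_iterate_eq hc₂ hp₂ hpc hp
  have hrc : ∃ n : ℕ, (joinParent q c T₁ par₁ par₂)^[n] c = q := ⟨1, hpc⟩
  generalize joinParent q c T₁ par₁ par₂ = par at *
  generalize joinTime d q c T₁ t₁ t₂ = t at *
  obtain ⟨a0, a1, a2, -, a4⟩ := h₁
  obtain ⟨b0, b1, b2, -, b4⟩ := h₂
  have hm₁ : ∀ p ∈ T₁, par₁ p = c ∨ par₁ p ∈ T₁ := fun p hp =>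
    (a1 p hp (fun h => hc₁ (h ▸ hp))).1
  have hm₂ : ∀ p ∈ T₂, par₂ p = c ∨ par₂ p ∈ T₂ := fun p hp =>
    (b1 p hp (fun h => hc₂ (h ▸ hp))).1
  have hd : ∀ p ∈ T₁, p ∉ T₂ := fun p hp => Finset.disjoint_left.1 hT hp
  have hroot : ∀ x ∈ insert c (T₁ ∪ T₂), par x = q → x = c := by
    intro x hx hxq
    simp only [Finset.mem_insert, Finset.mem_union] at hx
    grind
  refine ⟨ht₀, ?_, fun x hx _ hxq y hy _ hyq => (hroot x hx hxq).trans (hroot y hy hyq).symm,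
    fun _ => ⟨c, Finset.mem_insert_self _ _, hqc.symm, hpc⟩, ?_⟩
  · intro p hp _
    simp only [Finset.mem_insert, Finset.mem_union] at hp ⊢
    rcases hp with rfl | hp | hp
    · exact ⟨.inl hpc, by rw [hpc, ht₀, htc, zero_add], hrc⟩
    · obtain ⟨hm, ht, -⟩ := a1 p hp (fun h => hc₁ (h ▸ hp))
      refine ⟨by grind, ?_, hr₁ p hp⟩
      rw [ht₁ p hp, ht, hp₁ p hp]
      rcases hm with hm | hm
      · rw [hm, a0, htc]; ring
      · rw [ht₁ _ hm]; ring
    · obtain ⟨hm, ht, -⟩ := b1 p hp (fun h => hc₂ (h ▸ hp))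
      refine ⟨by grind, ?_, hr₂ p hp⟩
      rw [ht₂ p hp, ht, hp₂ p hp]
      rcases hm with hm | hm
      · rw [hm, b0, htc]; ring
      · rw [ht₂ _ hm]; ring
  · intro r hr _ x hx y hy z hz _ _ _ hxr hyr hzr
    simp only [Finset.mem_insert, Finset.mem_union] at hr
    rcases hr with rfl | hr | hr
    · have key : ∀ x ∈ insert r (T₁ ∪ T₂), par x = r →
          x ≠ r ∧ (x ∈ T₁ ∧ par₁ x = r ∨ x ∈ T₂ ∧ par₂ x = r) := by
        intro x hx hxr
        simp only [Finset.mem_insert, Finset.mem_union] at hx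
        grind
      obtain ⟨nx, ⟨kx, kx'⟩ | ⟨kx, kx'⟩⟩ := key x hx hxr <;>
      obtain ⟨ny, ⟨ky, ky'⟩ | ⟨ky, ky'⟩⟩ := key y hy hyr <;>
      obtain ⟨nz, ⟨kz, kz'⟩ | ⟨kz, kz'⟩⟩ := key z hz hzr <;>
      first
      | exact .inl (a2 x kx nx kx' y ky ny ky')
      | exact .inl (b2 x kx nx kx' y ky ny ky')
      | exact .inr (.inl (a2 x kx nx kx' z kz nz kz'))
      | exact .inr (.inl (b2 x kx nx kx' z kz nz kz'))
      | exact .inr (.inr (a2 y ky ny ky' z kz nz kz'))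
      | exact .inr (.inr (b2 y ky ny ky' z kz nz kz'))
    · have key : ∀ x ∈ insert c (T₁ ∪ T₂), par x = r → x ∈ T₁ ∧ x ≠ c ∧ par₁ x = r := by
        intro x hx hxr
        simp only [Finset.mem_insert, Finset.mem_union] at hx
        grind
      obtain ⟨kx, kx', kx''⟩ := key x hx hxr
      obtain ⟨ky, ky', ky''⟩ := key y hy hyr
      obtain ⟨kz, kz', kz''⟩ := key z hz hzr
      exact a4 r hr (fun h => hc₁ (h ▸ hr)) x kx y ky z kz kx' ky' kz' kx'' ky'' kz''
    · have key : ∀ x ∈ insert c (T₁ ∪ T₂), par x = r → x ∈ T₂ ∧ x ≠ c ∧ par₂ x = r := by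
        intro x hx hxr
        simp only [Finset.mem_insert, Finset.mem_union] at hx
        grind
      obtain ⟨kx, kx', kx''⟩ := key x hx hxr
      obtain ⟨ky, ky', ky''⟩ := key y hy hyr
      obtain ⟨kz, kz', kz''⟩ := key z hz hzr
      exact b4 r hr (fun h => hc₂ (h ▸ hr)) x kx y ky z kz kx' ky' kz' kx'' ky'' kz''

end IsWakeUpTree

/-- Let the distance be bounded by the variation of two coordinates `f` and `g`. A set of points
whose `g`-coordinates lie in an interval of length `w` is woken up by going to the point with
smallest `f`-coordinate, and then treating separately the two halves of the interval. -/
theorem exists_isWakeUpTree_of_strip {X : Type*} {d : X → X → ℝ} {f g : X → ℝ}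
    (hd : ∀ p q, f p ≤ f q → d p q ≤ f q - f p + |g q - g p|) (T : Finset X) {q : X} (hq : q ∉ T)
    {a w B : ℝ} (hg : ∀ p ∈ T, g p ∈ Set.Icc a (a + w)) (hB : ∀ p ∈ T, d q p ≤ B + f p) :
    ∃ (par : X → X) (t : X → ℝ), IsWakeUpTree d q T par t ∧ ∀ p ∈ T, t p ≤ B + f p + 2 * w := by
  classical
  induction T using Finset.strongInduction generalizing q a w B with
  | H T ih =>
  rcases T.eq_empty_or_nonempty with rfl | hT
  · exact ⟨id, 0, .empty d q, by simp⟩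
  obtain ⟨c, hc, hmin⟩ := T.exists_min_image f hT
  have hw : 0 ≤ w := by linarith [(hg c hc).1, (hg c hc).2]
  set T₁ := (T.erase c).filter (fun p => g p ≤ a + w / 2) with hT₁
  set T₂ := (T.erase c).filter (fun p => ¬ g p ≤ a + w / 2) with hT₂
  have hunion : insert c (T₁ ∪ T₂) = T := by
    rw [hT₁, hT₂, Finset.filter_union_filter_not_eq, Finset.insert_erase hc]
  have hsub₁ : T₁ ⊆ T.erase c := Finset.filter_subset _ _
  have hsub₂ : T₂ ⊆ T.erase c := Finset.filter_subset _ _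
  have hc₁ : c ∉ T₁ := fun h => Finset.notMem_erase c T (hsub₁ h)
  have hc₂ : c ∉ T₂ := fun h => Finset.notMem_erase c T (hsub₂ h)
  have hdc : ∀ p ∈ T.erase c, d c p ≤ (w - f c) + f p := by
    intro p hp
    have hp := Finset.mem_of_mem_erase hp
    have habs : |g p - g c| ≤ w := by
      rw [abs_le]
      constructor <;> linarith [(hg c hc).1, (hg c hc).2, (hg p hp).1, (hg p hp).2]
    linarith [hd c p (hmin p hp)]
  obtain ⟨par₁, t₁, htree₁, hb₁⟩ := ih T₁ (hsub₁.trans_ssubset (Finset.erase_ssubset hc)) hc₁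
    (a := a) (w := w / 2) (B := w - f c)
    (fun p hp => ⟨(hg p (Finset.mem_of_mem_erase (hsub₁ hp))).1, (Finset.mem_filter.1 hp).2⟩)
    (fun p hp => hdc p (hsub₁ hp))
  obtain ⟨par₂, t₂, htree₂, hb₂⟩ := ih T₂ (hsub₂.trans_ssubset (Finset.erase_ssubset hc)) hc₂
    (a := a + w / 2) (w := w / 2) (B := w - f c)
    (fun p hp => ⟨(not_le.1 (Finset.mem_filter.1 hp).2).le,
      by linarith [(hg p (Finset.mem_of_mem_erase (hsub₂ hp))).2]⟩)
    (fun p hp => hdc p (hsub₂ hp))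
  have htree := htree₁.join htree₂ (Finset.disjoint_filter_filter_not _ _ _) hc₁ hc₂
    (fun h => hq (Finset.mem_of_mem_erase (hsub₁ h)))
    (fun h => hq (Finset.mem_of_mem_erase (hsub₂ h))) (fun h => hq (h ▸ hc))
  rw [hunion] at htree
  refine ⟨_, _, htree, fun p hp => ?_⟩
  have hBc := hB c hc
  have hpq : p ≠ q := fun h => hq (h ▸ hp)
  by_cases hpc : p = c
  · subst hpc
    simp only [joinTime, hpq, if_false, if_true]
    linarith
  · rw [← hunion] at hp
    simp only [joinTime, hpq, hpc, if_false]
    split_ifs with h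
    · linarith [hb₁ p h]
    · linarith [hb₂ p (by simpa [hpc, h] using hp)]

theorem EuclideanSpace.dist_le_abs_add_abs (p q : EuclideanSpace ℝ (Fin 2)) :
    dist p q ≤ |q 0 - p 0| + |q 1 - p 1| := by
  rw [EuclideanSpace.dist_eq, Fin.sum_univ_two, Real.dist_eq, Real.dist_eq,
    abs_sub_comm (p 0), abs_sub_comm (p 1)]
  refine Real.sqrt_le_iff.2 ⟨by positivity, ?_⟩
  nlinarith [mul_nonneg (abs_nonneg (q 0 - p 0)) (abs_nonneg (q 1 - p 1))]

/-- the Arc-Strategy bound: any finite set of points in the closed Euclidean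
unit disk admits a wake-up tree rooted at the origin with makespan at most `7.9651`. -/
theorem freezeTag_unitDisk_arcStrategy_makespan_le (S : Finset (EuclideanSpace ℝ (Fin 2)))
    (hS : ∀ p ∈ S, ‖p‖ ≤ 1) :
    ∃ (parent : EuclideanSpace ℝ (Fin 2) → EuclideanSpace ℝ (Fin 2))
      (t : EuclideanSpace ℝ (Fin 2) → ℝ),
      IsWakeUpTree dist (0 : EuclideanSpace ℝ (Fin 2)) S parent t ∧
      ∀ p ∈ S, t p ≤ 7.9651 := by
  have hcoord : ∀ p ∈ S, ∀ i, |p i| ≤ 1 := fun p hp i =>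
    (PiLp.norm_apply_le p i).trans (hS p hp)
  obtain ⟨par, t, htree, ht⟩ := exists_isWakeUpTree_of_strip
    (d := dist) (f := fun p : EuclideanSpace ℝ (Fin 2) => p 0) (g := fun p => p 1)
    (a := -1) (w := 2) (B := 2)
    (fun p q h => by
      simpa [abs_of_nonneg (sub_nonneg.2 h)] using EuclideanSpace.dist_le_abs_add_abs p q)
    (S.erase 0) (Finset.notMem_erase 0 S)
    (fun p hp => by
      have h := abs_le.1 (hcoord p (Finset.mem_of_mem_erase hp) 1)
      exact ⟨h.1, by linarith [h.2]⟩)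
    (fun p hp => by
      have hp := Finset.mem_of_mem_erase hp
      rw [dist_zero_left]
      linarith [hS p hp, (abs_le.1 (hcoord p hp 0)).1])
  refine ⟨par, t, htree.of_erase, fun p hp => ?_⟩
  by_cases h : p = 0
  · rw [h, htree.1]
    norm_num
  · have h1 := ht p (Finset.mem_erase.2 ⟨h, hp⟩)
    have h2 := (abs_le.1 (hcoord p hp 0)).2
    norm_num at h1 ⊢
    linarith
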